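/- D_max for identity versus a conditional expectation onto a single block: let A, B be finite-dimensional Hilbert spaces, ω a positive definite state on B, and define Q(ρ) = ρ_A ⊗ ω for states ρ on A⊗B (i.e. Q = id_A ⊗ R_ω with R_ω the replacer channel). Then sup over states ρ on A⊗B of the smallest λ ≥ 0 with ρ ≤ 2^λ Q(ρ) equals log Tr_{min(d_A, d_B)}(ω^{-1}), the log of the sum of the min(d_A,d_B) largest eigenvalues of ω^{-1}. -/

import Mathlib

open ComplexOrder

open Kronecker

theorem exists_card_eq_isGreatest_sum {n : Type*} [Fintype n] [DecidableEq n] (μ : n → ℝ) {k : ℕ}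
    (hk : k ≤ Fintype.card n) :
    ∃ s : Finset n, s.card = k ∧
      IsGreatest {y : ℝ | ∃ s : Finset n, s.card = k ∧ y = ∑ j ∈ s, μ j} (∑ j ∈ s, μ j) := by
  have hne : (Finset.powersetCard k (Finset.univ : Finset n)).Nonempty :=
    Finset.powersetCard_nonempty.2 (by simpa using hk)
  obtain ⟨s, hs, hmax⟩ := Finset.exists_max_image _ (fun s : Finset n => ∑ j ∈ s, μ j) hne
  have hs' := (Finset.mem_powersetCard.1 hs).2
  refine ⟨s, hs', ⟨s, hs', rfl⟩, ?_⟩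
  rintro _ ⟨t, ht, rfl⟩
  exact hmax t (Finset.mem_powersetCard.2 ⟨Finset.subset_univ _, ht⟩)

/-- Ky Fan's principle in its combinatorial form. -/
theorem sum_mul_le_sum_of_forall_card_eq {n : Type*} [Fintype n] [DecidableEq n] {μ p : n → ℝ}
    (hμ : ∀ j, 0 ≤ μ j) (hp : ∀ j, 0 ≤ p j) (hp1 : ∀ j, p j ≤ 1) {k : ℕ} (hk : 0 < k)
    (hsum : ∑ j, p j ≤ k) {s : Finset n} (hs : s.card = k)
    (hmax : ∀ t : Finset n, t.card = k → ∑ j ∈ t, μ j ≤ ∑ j ∈ s, μ j) :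
    ∑ j, μ j * p j ≤ ∑ j ∈ s, μ j := by
  have hne : s.Nonempty := Finset.card_pos.1 (hs ▸ hk)
  obtain ⟨i, hi, hmin⟩ := Finset.exists_min_image s μ hne
  have hout : ∀ j, j ∉ s → μ j ≤ μ i := by
    intro j hj
    have hj' : j ∉ s.erase i := fun h => hj (Finset.mem_of_mem_erase h)
    have h := hmax (insert j (s.erase i)) (by
      rw [Finset.card_insert_of_notMem hj', Finset.card_erase_of_mem hi, hs]; omega)
    rw [Finset.sum_insert hj', ← Finset.add_sum_erase s μ hi] at h
    linarith
  have hpt : ∀ j, μ j * p j ≤ (if j ∈ s then μ j else 0) + μ i * (p j - if j ∈ s then 1 else 0) := by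
    intro j
    split_ifs with h
    · nlinarith [hmin j h, hp1 j]
    · nlinarith [hout j h, hp j]
  calc ∑ j, μ j * p j
      ≤ ∑ j, ((if j ∈ s then μ j else 0) + μ i * (p j - if j ∈ s then 1 else 0)) :=
        Finset.sum_le_sum fun j _ => hpt j
    _ = ∑ j ∈ s, μ j + μ i * (∑ j, p j - k) := by
        rw [Finset.sum_add_distrib, ← Finset.mul_sum, Finset.sum_sub_distrib]
        simp [hs]
    _ ≤ ∑ j ∈ s, μ j := by
        nlinarith [hμ i]

theorem norm_trace_mul_conjTranspose_sq_le {n r : Type*} [Fintype n] [Fintype r]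
    (A B : Matrix n r ℂ) {μ : n → ℝ} (hμ : ∀ j, 0 < μ j) :
    ‖(A * B.conjTranspose).trace‖ ^ 2 ≤
      (∑ j, μ j * ∑ i, ‖B j i‖ ^ 2) * ∑ j, (μ j)⁻¹ * ∑ i, ‖A j i‖ ^ 2 := by
  have h1 : ‖(A * B.conjTranspose).trace‖ ≤ ∑ x : n × r, ‖A x.1 x.2‖ * ‖B x.1 x.2‖ := by
    rw [Fintype.sum_prod_type]
    simp only [Matrix.trace, Matrix.diag, Matrix.mul_apply, Matrix.conjTranspose_apply]
    refine (norm_sum_le _ _).trans (Finset.sum_le_sum fun j _ => (norm_sum_le _ _).trans ?_)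
    simp
  refine (pow_le_pow_left₀ (norm_nonneg _) h1 2).trans ?_
  simp only [Finset.mul_sum (Finset.univ : Finset r)]
  rw [← Fintype.sum_prod_type' (f := fun j i => μ j * ‖B j i‖ ^ 2),
    ← Fintype.sum_prod_type' (f := fun j i => (μ j)⁻¹ * ‖A j i‖ ^ 2)]
  refine Finset.sum_sq_le_sum_mul_sum_of_sq_le_mul _ (fun x _ => ?_) (fun x _ => ?_) (fun x _ => ?_)
  · have := hμ x.1; positivity
  · have := hμ x.1; positivity
  · have := (hμ x.1).ne'
    refine le_of_eq ?_
    field_simp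

theorem trace_conjTranspose_mul_diagonal_mul {n r : Type*} [Fintype n] [Fintype r] [DecidableEq n]
    (A : Matrix n r ℂ) (d : n → ℝ) :
    (A.conjTranspose * Matrix.diagonal (fun j => (d j : ℂ)) * A).trace =
      ((∑ j, d j * ∑ i, ‖A j i‖ ^ 2 : ℝ) : ℂ) := by
  simp only [Matrix.trace, Matrix.diag, Matrix.mul_apply, Matrix.conjTranspose_apply,
    Matrix.diagonal_apply, mul_ite, mul_zero, Finset.sum_ite_eq', Finset.mem_univ, if_true]
  rw [Finset.sum_comm]
  push_cast
  refine Finset.sum_congr rfl fun j _ => ?_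
  rw [Finset.mul_sum]
  refine Finset.sum_congr rfl fun i _ => ?_
  rw [← Complex.conj_mul']
  simp only [RCLike.star_def]
  ring

theorem mul_conjTranspose_self_apply_diag {n r : Type*} [Fintype r] (C : Matrix n r ℂ) (j : n) :
    (C * C.conjTranspose) j j = ((∑ i, ‖C j i‖ ^ 2 : ℝ) : ℂ) := by
  simp [Matrix.mul_apply, Complex.mul_conj']

theorem sum_norm_sq_row_le_one {n r : Type*} [Fintype n] [Fintype r] [DecidableEq n]
    [DecidableEq r] {B : Matrix n r ℂ} (hB : B.conjTranspose * B = 1) (j : n) :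
    ∑ i, ‖B j i‖ ^ 2 ≤ 1 := by
  have hP : (B * B.conjTranspose) * (B * B.conjTranspose).conjTranspose = B * B.conjTranspose := by
    rw [Matrix.conjTranspose_mul, Matrix.conjTranspose_conjTranspose, Matrix.mul_assoc,
      ← Matrix.mul_assoc _ B, hB, Matrix.one_mul]
  have h1 := congrFun (congrFun hP j) j
  rw [mul_conjTranspose_self_apply_diag] at h1
  have h2 := mul_conjTranspose_self_apply_diag B j
  rw [h2, Complex.ofReal_inj] at h1
  have h3 : ‖(B * B.conjTranspose) j j‖ ^ 2 ≤ ∑ i, ‖(B * B.conjTranspose) j i‖ ^ 2 :=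
    Finset.single_le_sum (f := fun i => ‖(B * B.conjTranspose) j i‖ ^ 2)
      (fun _ _ => by positivity) (Finset.mem_univ j)
  rw [h1, h2, Complex.norm_real, Real.norm_eq_abs, sq_abs] at h3
  have h4 : (0 : ℝ) ≤ ∑ i, ‖B j i‖ ^ 2 := by positivity
  nlinarith

theorem sum_sum_norm_sq_eq_card {n r : Type*} [Fintype n] [Fintype r]
    [DecidableEq r] {B : Matrix n r ℂ} (hB : B.conjTranspose * B = 1) :
    ∑ j, ∑ i, ‖B j i‖ ^ 2 = Fintype.card r := by
  classical
  have h := trace_conjTranspose_mul_diagonal_mul B (fun _ => 1)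
  simp only [Complex.ofReal_one, Matrix.diagonal_one, Matrix.mul_one, hB, Matrix.trace_one,
    one_mul] at h
  exact_mod_cast h.symm

theorem exists_isometry_factorization {m n : Type*} [Fintype m] [Fintype n] (X : Matrix m n ℂ) :
    ∃ (r : ℕ) (C : Matrix m (Fin r) ℂ) (U : Matrix n (Fin r) ℂ),
      r ≤ min (Fintype.card m) (Fintype.card n) ∧
        U.conjTranspose * U = 1 ∧ X = C * U.conjTranspose := by
  let S : Submodule ℂ (EuclideanSpace ℂ n) :=
    Submodule.span ℂ (Set.range fun a => WithLp.toLp 2 (star (X a)))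
  let b := stdOrthonormalBasis ℂ S
  have hS : ∀ a, WithLp.toLp 2 (star (X a)) ∈ S := fun a => Submodule.subset_span ⟨a, rfl⟩
  refine ⟨Module.finrank ℂ S, Matrix.of fun a i => star (inner ℂ (b i) ⟨_, hS a⟩),
    Matrix.of fun c i => (b i : EuclideanSpace ℂ n) c, le_min ?_ ?_, ?_, ?_⟩
  · exact finrank_range_le_card _
  · simpa using Submodule.finrank_le S
  · ext i j
    have := orthonormal_iff_ite.1 b.orthonormal i j
    simp only [Submodule.coe_inner, EuclideanSpace.inner_eq_star_dotProduct] at this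
    simp only [Matrix.mul_apply, Matrix.conjTranspose_apply, Matrix.of_apply, Matrix.one_apply]
    rw [← this]
    simp [dotProduct, mul_comm]
  · ext a c
    have h := congrArg (fun x : S => star ((x : EuclideanSpace ℂ n) c)) (b.sum_repr' ⟨_, hS a⟩)
    simp only [Submodule.coe_sum, WithLp.ofLp_sum, Finset.sum_apply, star_sum] at h
    simp only [Matrix.mul_apply, Matrix.conjTranspose_apply, Matrix.of_apply]
    simpa using h.symm

theorem norm_trace_sq_le {m n : Type*} [Fintype m] [Fintype n] [DecidableEq n]
    {V ω : Matrix n n ℂ} {μ : n → ℝ} (hV : V * V.conjTranspose = 1) (hμ : ∀ j, 0 < μ j)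
    (hω : ω = V * Matrix.diagonal (fun j => (((μ j)⁻¹ : ℝ) : ℂ)) * V.conjTranspose)
    {s : Finset n} (hs : s.card = min (Fintype.card m) (Fintype.card n)) (hs0 : 0 < s.card)
    (hmax : ∀ t : Finset n, t.card = s.card → ∑ j ∈ t, μ j ≤ ∑ j ∈ s, μ j)
    (Y : Matrix n m ℂ) (X : Matrix m n ℂ) :
    ((‖(Y * X).trace‖ ^ 2 : ℝ) : ℂ) ≤
      ((∑ j ∈ s, μ j : ℝ) : ℂ) * ((Y * X).conjTranspose * ω * (Y * X)).trace := by
  obtain ⟨r, C, U, hr, hU, rfl⟩ := exists_isometry_factorization X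
  set A := V.conjTranspose * (Y * C) with hA
  set B := V.conjTranspose * U with hBdef
  have hB : B.conjTranspose * B = 1 := by
    rw [hBdef, Matrix.conjTranspose_mul, Matrix.conjTranspose_conjTranspose, Matrix.mul_assoc,
      ← Matrix.mul_assoc V, hV, Matrix.one_mul, hU]
  have hZ : Y * (C * U.conjTranspose) = V * (A * B.conjTranspose) * V.conjTranspose := by
    rw [hA, hBdef, Matrix.conjTranspose_mul, Matrix.conjTranspose_conjTranspose]
    calc _ = 1 * (Y * (C * U.conjTranspose)) * 1 := by simp
      _ = _ := by rw [← hV]; simp only [Matrix.mul_assoc]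
  have hV' : V.conjTranspose * V = 1 := mul_eq_one_comm.1 hV
  have ht : (Y * (C * U.conjTranspose)).trace = (A * B.conjTranspose).trace := by
    rw [hZ, Matrix.trace_mul_comm, ← Matrix.mul_assoc, hV', Matrix.one_mul]
  have hq : ((Y * (C * U.conjTranspose)).conjTranspose * ω * (Y * (C * U.conjTranspose))).trace =
      ((∑ j, (μ j)⁻¹ * ∑ i, ‖A j i‖ ^ 2 : ℝ) : ℂ) := by
    rw [← trace_conjTranspose_mul_diagonal_mul, hω]
    set D := Matrix.diagonal (fun j => (((μ j)⁻¹ : ℝ) : ℂ))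
    have : (Y * (C * U.conjTranspose)).conjTranspose * (V * D * V.conjTranspose) *
        (Y * (C * U.conjTranspose)) = U * (A.conjTranspose * D * A * U.conjTranspose) := by
      rw [hA]
      simp only [Matrix.conjTranspose_mul, Matrix.conjTranspose_conjTranspose, Matrix.mul_assoc]
    rw [this, Matrix.trace_mul_comm, Matrix.mul_assoc, hU, Matrix.mul_one]
  rw [ht, hq, ← Complex.ofReal_mul, Complex.real_le_real]
  refine (norm_trace_mul_conjTranspose_sq_le A B hμ).trans ?_
  refine mul_le_mul_of_nonneg_right ?_ (Finset.sum_nonneg fun j _ => ?_)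
  · refine sum_mul_le_sum_of_forall_card_eq (fun j => (hμ j).le) (fun j => by positivity)
      (sum_norm_sq_row_le_one hB) hs0 ?_ rfl hmax
    rw [sum_sum_norm_sq_eq_card hB, Fintype.card_fin, hs]
    exact_mod_cast hr
  · have := hμ j
    positivity

/-- The marginal on the first tensor factor. -/
abbrev marginal {m n : Type*} [Fintype n] (ρ : Matrix (m × n) (m × n) ℂ) : Matrix m m ℂ :=
  Matrix.of fun a a' => ∑ b, ρ (a, b) (a', b)

theorem dotProduct_marginal_kronecker_mulVec {m n : Type*} [Fintype m] [Fintype n]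
    (ω : Matrix n n ℂ) (ψ φ : m × n → ℂ) :
    dotProduct (star φ) ((marginal (Matrix.vecMulVec ψ (star ψ)) ⊗ₖ ω).mulVec φ) =
      (((Matrix.of fun b a => φ (a, b)) * (Matrix.of fun a b => star (ψ (a, b)))).conjTranspose *
        ω * ((Matrix.of fun b a => φ (a, b)) * (Matrix.of fun a b => star (ψ (a, b))))).trace := by
  simp only [dotProduct, Matrix.mulVec, Matrix.trace, Matrix.diag, Matrix.mul_apply,
    Matrix.conjTranspose_apply, Matrix.of_apply, Matrix.kroneckerMap_apply, Matrix.vecMulVec_apply,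
    Pi.star_apply, Fintype.sum_prod_type, Finset.mul_sum, Finset.sum_mul, star_sum, star_mul',
    star_star]
  calc _ = ∑ x : m × n × m × n × n, star (φ (x.1, x.2.1)) *
          (ψ (x.1, x.2.2.2.2) * star (ψ (x.2.2.1, x.2.2.2.2)) * ω x.2.1 x.2.2.2.1 *
            φ (x.2.2.1, x.2.2.2.1)) := by
        simp only [Fintype.sum_prod_type]
    _ = ∑ x : n × n × m × n × m, star (φ (x.2.2.2.2, x.2.2.2.1)) * ψ (x.2.2.2.2, x.1) *
          ω x.2.2.2.1 x.2.1 * (φ (x.2.2.1, x.2.1) * star (ψ (x.2.2.1, x.1))) := by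
        refine Fintype.sum_equiv
          ⟨fun x => (x.2.2.2.2, x.2.2.2.1, x.2.2.1, x.2.1, x.1),
            fun x => (x.2.2.2.2, x.2.2.2.1, x.2.2.1, x.2.1, x.1), fun _ => rfl, fun _ => rfl⟩
          _ _ fun x => ?_
        simp only [Equiv.coe_fn_mk]
        ring
    _ = _ := by
        simp only [Fintype.sum_prod_type]

theorem dotProduct_vecMulVec_mulVec {m n : Type*} [Fintype m] [Fintype n] (ψ φ : m × n → ℂ) :
    dotProduct (star φ) ((Matrix.vecMulVec ψ (star ψ)).mulVec φ) =
      ((‖((Matrix.of fun b a => φ (a, b)) *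
        (Matrix.of fun a b => star (ψ (a, b)))).trace‖ ^ 2 : ℝ) : ℂ) := by
  have h : ((Matrix.of fun b a => φ (a, b)) * (Matrix.of fun a b => star (ψ (a, b)))).trace =
      dotProduct (star ψ) φ := by
    simp only [Matrix.trace, Matrix.diag, Matrix.mul_apply, Matrix.of_apply, dotProduct,
      Fintype.sum_prod_type, Pi.star_apply]
    rw [Finset.sum_comm]
    simp only [mul_comm]
  rw [h, Matrix.vecMulVec_mulVec, Complex.ofReal_pow, ← Complex.mul_conj', starRingEnd_apply,
    dotProduct_smul, op_smul_eq_mul, Matrix.star_dotProduct φ ψ, mul_comm]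

theorem marginal_isHermitian {m n : Type*} [Fintype n] {ρ : Matrix (m × n) (m × n) ℂ}
    (hρ : ρ.IsHermitian) : (marginal ρ).IsHermitian := by
  ext a a'
  simp only [Matrix.conjTranspose_apply, Matrix.of_apply, star_sum]
  exact Finset.sum_congr rfl fun b _ => hρ.apply _ _

theorem isHermitian_smul_marginal_kronecker_sub {m n : Type*} [Fintype n] {ω : Matrix n n ℂ}
    (hω : ω.IsHermitian) {ρ : Matrix (m × n) (m × n) ℂ} (hρ : ρ.IsHermitian) (t : ℝ) :
    (t • (marginal ρ ⊗ₖ ω) - ρ).IsHermitian := by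
  refine Matrix.IsHermitian.sub ?_ hρ
  rw [Matrix.IsHermitian, Matrix.conjTranspose_smul, Matrix.conjTranspose_kronecker, hω.eq,
    (marginal_isHermitian hρ).eq, star_trivial]

theorem posSemidef_smul_marginal_kronecker_sub_vecMulVec_iff {m n : Type*} [Fintype m] [Fintype n]
    {ω : Matrix n n ℂ} (hω : ω.IsHermitian) (ψ : m × n → ℂ) (t : ℝ) :
    (t • (marginal (Matrix.vecMulVec ψ (star ψ)) ⊗ₖ ω) -
        Matrix.vecMulVec ψ (star ψ)).PosSemidef ↔
      ∀ φ : m × n → ℂ,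
        ((‖((Matrix.of fun b a => φ (a, b)) *
          (Matrix.of fun a b => star (ψ (a, b)))).trace‖ ^ 2 : ℝ) : ℂ) ≤
        (t : ℂ) * (((Matrix.of fun b a => φ (a, b)) *
            (Matrix.of fun a b => star (ψ (a, b)))).conjTranspose * ω *
          ((Matrix.of fun b a => φ (a, b)) * (Matrix.of fun a b => star (ψ (a, b))))).trace := by
  rw [Matrix.posSemidef_iff_dotProduct_mulVec, and_iff_right
    (isHermitian_smul_marginal_kronecker_sub hω (Matrix.posSemidef_vecMulVec_self_star ψ).1 t)]
  refine forall_congr' fun φ => ?_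
  rw [Matrix.sub_mulVec, dotProduct_sub, Matrix.smul_mulVec, dotProduct_smul,
    dotProduct_vecMulVec_mulVec, dotProduct_marginal_kronecker_mulVec, sub_nonneg,
    Complex.real_smul]

open scoped MatrixOrder in
theorem exists_eq_sum_vecMulVec {n : Type*} [Fintype n] {ρ : Matrix n n ℂ} (hρ : ρ.PosSemidef) :
    ∃ ψ : n → n → ℂ, ρ = ∑ i, Matrix.vecMulVec (ψ i) (star (ψ i)) := by
  classical
  obtain ⟨B, rfl⟩ := CStarAlgebra.nonneg_iff_eq_star_mul_self.mp hρ.nonneg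
  refine ⟨fun i => star (B i), ?_⟩
  ext p q
  simp [Matrix.sum_apply, Matrix.mul_apply, Matrix.vecMulVec_apply, Matrix.star_eq_conjTranspose]

/-- The operator inequality `ρ ≤ Tr_k(ω⁻¹) • (ρ_A ⊗ ω)`. -/
theorem posSemidef_sum_smul_marginal_kronecker_sub {m n : Type*} [Fintype m] [Fintype n]
    [DecidableEq n]
    {V ω : Matrix n n ℂ} {μ : n → ℝ} (hV : V * V.conjTranspose = 1) (hμ : ∀ j, 0 < μ j)
    (hω : ω = V * Matrix.diagonal (fun j => (((μ j)⁻¹ : ℝ) : ℂ)) * V.conjTranspose)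
    (hωh : ω.IsHermitian)
    {s : Finset n} (hs : s.card = min (Fintype.card m) (Fintype.card n)) (hs0 : 0 < s.card)
    (hmax : ∀ t : Finset n, t.card = s.card → ∑ j ∈ t, μ j ≤ ∑ j ∈ s, μ j)
    {ρ : Matrix (m × n) (m × n) ℂ} (hρ : ρ.PosSemidef) :
    ((∑ j ∈ s, μ j) • (marginal ρ ⊗ₖ ω) - ρ).PosSemidef := by
  obtain ⟨ψ, rfl⟩ := exists_eq_sum_vecMulVec hρ
  have h : (∑ j ∈ s, μ j) • (marginal (∑ i, Matrix.vecMulVec (ψ i) (star (ψ i))) ⊗ₖ ω) -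
      ∑ i, Matrix.vecMulVec (ψ i) (star (ψ i)) =
      ∑ i, ((∑ j ∈ s, μ j) • (marginal (Matrix.vecMulVec (ψ i) (star (ψ i))) ⊗ₖ ω) -
        Matrix.vecMulVec (ψ i) (star (ψ i))) := by
    rw [Finset.sum_sub_distrib, ← Finset.smul_sum]
    congr 2
    ext p q
    simp only [Matrix.kroneckerMap_apply, Matrix.of_apply, Matrix.sum_apply]
    rw [Finset.sum_comm, Finset.sum_mul]
  rw [h]
  exact Matrix.posSemidef_sum _ fun i _ =>
    (posSemidef_smul_marginal_kronecker_sub_vecMulVec_iff hωh (ψ i) _).2 fun φ =>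
      norm_trace_sq_le hV hμ hω hs hs0 hmax _ _

theorem trace_marginal_kronecker {m n : Type*} [Fintype m] [Fintype n]
    (ω : Matrix n n ℂ) (ρ : Matrix (m × n) (m × n) ℂ) :
    (marginal ρ ⊗ₖ ω).trace = ρ.trace * ω.trace := by
  rw [Matrix.trace_kronecker]
  simp [Matrix.trace, Fintype.sum_prod_type]

theorem one_le_of_posSemidef_smul_marginal_kronecker_sub {m n : Type*} [Fintype m] [Fintype n]
    {ω : Matrix n n ℂ} (htr : ω.trace = 1) {ρ : Matrix (m × n) (m × n) ℂ} (hρ : ρ.trace = 1)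
    {t : ℝ} (h : (t • (marginal ρ ⊗ₖ ω) - ρ).PosSemidef) : 1 ≤ t := by
  have h1 := h.trace_nonneg
  rw [Matrix.trace_sub, Matrix.trace_smul, trace_marginal_kronecker, hρ, htr, mul_one,
    Complex.real_smul, mul_one, sub_nonneg] at h1
  exact_mod_cast h1

/-- A pure state whose `D_max` against its image attains the Ky Fan sum over `s`. -/
theorem exists_pure_state_sum_le {m n : Type*} [Fintype m] [Fintype n] [DecidableEq n]
    {V ω : Matrix n n ℂ} {μ : n → ℝ} (hV : V * V.conjTranspose = 1) (hμ : ∀ j, 0 < μ j)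
    (hω : ω = V * Matrix.diagonal (fun j => (((μ j)⁻¹ : ℝ) : ℂ)) * V.conjTranspose)
    (hωh : ω.IsHermitian) {s : Finset n} (hs : s.card ≤ Fintype.card m) (hs0 : 0 < s.card) :
    ∃ ρ : Matrix (m × n) (m × n) ℂ, ρ.PosSemidef ∧ ρ.trace = 1 ∧
      ∀ t : ℝ, (t • (marginal ρ ⊗ₖ ω) - ρ).PosSemidef → ∑ j ∈ s, μ j ≤ t := by
  classical
  have hV' : V.conjTranspose * V = 1 := mul_eq_one_comm.1 hV
  obtain ⟨ι⟩ : Nonempty (s ↪ m) := Function.Embedding.nonempty_of_card_le (by simpa using hs)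
  let E : Matrix n m ℂ := Matrix.of fun j a => if h : j ∈ s then (if ι ⟨j, h⟩ = a then 1 else 0) else 0
  let c : ℝ := (Real.sqrt s.card)⁻¹
  have hc : c ^ 2 * s.card = 1 := by
    have : (0 : ℝ) < s.card := by exact_mod_cast hs0
    simp only [c, inv_pow]
    rw [Real.sq_sqrt this.le]
    field_simp
  have hc0 : 0 < c ^ 2 := by
    have : (0 : ℝ) < s.card := by exact_mod_cast hs0
    positivity
  have hE : E * E.conjTranspose = Matrix.diagonal fun j => if j ∈ s then 1 else 0 := by
    ext i j
    simp only [Matrix.mul_apply, Matrix.conjTranspose_apply, Matrix.diagonal_apply, E,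
      Matrix.of_apply]
    by_cases hi : i ∈ s <;> by_cases hj : j ∈ s
    · simp [hi, hj]
    · simp [hi, hj]
      rintro rfl; exact (hj hi).elim
    · simp [hi]
    · simp [hi]
  let ψ : m × n → ℂ := fun p => c * (V * E) p.2 p.1
  let φ : m × n → ℂ := fun p => (V * Matrix.diagonal (fun j => (μ j : ℂ)) * E) p.2 p.1
  have hX : (Matrix.of fun a b => star (ψ (a, b))) =
      (c : ℂ) • (E.conjTranspose * V.conjTranspose) := by
    ext a b
    rw [← Matrix.conjTranspose_mul]
    simp only [ψ, Matrix.of_apply, Matrix.smul_apply, Matrix.conjTranspose_apply, star_mul',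
      RCLike.star_def, Complex.conj_ofReal, smul_eq_mul]
  have hψ : (Matrix.of fun b a => ψ (a, b)) = (c : ℂ) • (V * E) := by
    ext a b
    simp [ψ]
  have hY : (Matrix.of fun b a => φ (a, b)) = V * Matrix.diagonal (fun j => (μ j : ℂ)) * E := rfl
  refine ⟨Matrix.vecMulVec ψ (star ψ), Matrix.posSemidef_vecMulVec_self_star ψ, ?_, fun t ht => ?_⟩
  · have h : (Matrix.vecMulVec ψ (star ψ)).trace =
        ((Matrix.of fun b a => ψ (a, b)) * (Matrix.of fun a b => star (ψ (a, b)))).trace := by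
      simp only [Matrix.trace, Matrix.diag, Matrix.mul_apply, Matrix.of_apply,
        Matrix.vecMulVec_apply, Fintype.sum_prod_type, Pi.star_apply]
      rw [Finset.sum_comm]
    rw [h, hX, hψ, Matrix.smul_mul, Matrix.mul_smul, Matrix.mul_assoc, ← Matrix.mul_assoc E, hE,
      Matrix.trace_smul, Matrix.trace_smul, Matrix.trace_mul_comm, Matrix.mul_assoc, hV',
      Matrix.mul_one, Matrix.trace_diagonal]
    simp only [Finset.sum_ite_mem, Finset.univ_inter, Finset.sum_const, nsmul_eq_mul, mul_one,
      smul_eq_mul]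
    rw [← mul_assoc, ← sq]
    exact_mod_cast hc
  · have h := (posSemidef_smul_marginal_kronecker_sub_vecMulVec_iff hωh ψ t).1 ht φ
    have hZ : (Matrix.of fun b a => φ (a, b)) * (Matrix.of fun a b => star (ψ (a, b))) =
        (c : ℂ) • (V * Matrix.diagonal (fun j => if j ∈ s then (μ j : ℂ) else 0) *
          V.conjTranspose) := by
      rw [hX, hY, Matrix.mul_smul, Matrix.mul_assoc, ← Matrix.mul_assoc E, hE, ← Matrix.mul_assoc,
        Matrix.mul_assoc V, Matrix.diagonal_mul_diagonal]
      simp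
    have hconj : ∀ d : n → ℂ, (V * Matrix.diagonal d * V.conjTranspose).trace = ∑ j, d j := by
      intro d
      rw [Matrix.trace_mul_comm, ← Matrix.mul_assoc, hV', Matrix.one_mul, Matrix.trace_diagonal]
    have hmul : ∀ d e : n → ℂ, V * Matrix.diagonal d * V.conjTranspose *
        (V * Matrix.diagonal e * V.conjTranspose) =
          V * Matrix.diagonal (fun j => d j * e j) * V.conjTranspose := by
      intro d e
      rw [← Matrix.diagonal_mul_diagonal]
      calc _ = V * Matrix.diagonal d * (V.conjTranspose * V) * Matrix.diagonal e *
            V.conjTranspose := by simp only [Matrix.mul_assoc]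
        _ = _ := by rw [hV', Matrix.mul_one, Matrix.mul_assoc V]
    have hZc : ((c : ℂ) • (V * Matrix.diagonal (fun j => if j ∈ s then (μ j : ℂ) else 0) *
          V.conjTranspose)).conjTranspose =
        (c : ℂ) • (V * Matrix.diagonal (fun j => if j ∈ s then (μ j : ℂ) else 0) *
          V.conjTranspose) := by
      rw [Matrix.conjTranspose_smul, Matrix.conjTranspose_mul, Matrix.conjTranspose_mul,
        Matrix.conjTranspose_conjTranspose, Matrix.diagonal_conjTranspose, Matrix.mul_assoc]
      congr 4
      · simp
      · ext j
        simp only [Pi.star_apply]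
        split_ifs <;> simp
    have ht2 : ∀ j, (if j ∈ s then (μ j : ℂ) else 0) * (((μ j)⁻¹ : ℝ) : ℂ) *
        (if j ∈ s then (μ j : ℂ) else 0) = if j ∈ s then (μ j : ℂ) else 0 := by
      intro j
      have : (μ j : ℂ) ≠ 0 := by exact_mod_cast (hμ j).ne'
      split_ifs
      · push_cast
        field_simp
      · simp
    rw [hZ, hZc, hω, Matrix.trace_smul, hconj, Matrix.smul_mul, hmul, Matrix.smul_mul,
      Matrix.mul_smul, hmul, Matrix.trace_smul, Matrix.trace_smul, hconj] at h
    simp only [ht2, Finset.sum_ite_mem, Finset.univ_inter] at h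
    rw [← Complex.ofReal_sum, smul_eq_mul, smul_eq_mul, ← Complex.ofReal_mul,
      ← Complex.ofReal_mul, ← Complex.ofReal_mul, Complex.real_le_real,
      Complex.norm_real, Real.norm_eq_abs, sq_abs] at h
    have hM : 0 < ∑ j ∈ s, μ j := Finset.sum_pos (fun j _ => hμ j) (Finset.card_pos.1 hs0)
    have h' : (c ^ 2 * ∑ j ∈ s, μ j) * (∑ j ∈ s, μ j) ≤ (c ^ 2 * ∑ j ∈ s, μ j) * t := by
      linarith
    exact le_of_mul_le_mul_left h' (mul_pos hc0 hM)

theorem eq_eigenvectorUnitary_inv_mul {n : Type*} [Fintype n] [DecidableEq n] {ω : Matrix n n ℂ}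
    (hω : ω.PosDef) :
    ω = (hω.inv.1.eigenvectorUnitary : Matrix n n ℂ) *
      Matrix.diagonal (fun j => (((hω.inv.1.eigenvalues j)⁻¹ : ℝ) : ℂ)) *
      (hω.inv.1.eigenvectorUnitary : Matrix n n ℂ).conjTranspose := by
  set V := (hω.inv.1.eigenvectorUnitary : Matrix n n ℂ) with hVdef
  have hV : V * V.conjTranspose = 1 := Unitary.coe_mul_star_self hω.inv.1.eigenvectorUnitary
  have hV' : V.conjTranspose * V = 1 := mul_eq_one_comm.1 hV
  have hspec : ω⁻¹ = V * Matrix.diagonal (fun j => ((hω.inv.1.eigenvalues j : ℝ) : ℂ)) *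
      V.conjTranspose := hω.inv.1.spectral_theorem
  have hdet : IsUnit ω.det := (Matrix.isUnit_iff_isUnit_det ω).1 hω.isUnit
  refine (Matrix.nonsing_inv_nonsing_inv ω hdet).symm.trans (Matrix.inv_eq_right_inv ?_)
  refine (congrArg (· * _) hspec).trans ?_
  calc _ = V * (Matrix.diagonal (fun j => ((hω.inv.1.eigenvalues j : ℝ) : ℂ)) *
        (V.conjTranspose * V) *
        Matrix.diagonal (fun j => (((hω.inv.1.eigenvalues j)⁻¹ : ℝ) : ℂ))) *
        V.conjTranspose := by simp only [Matrix.mul_assoc]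
    _ = 1 := by
      rw [hV', Matrix.mul_one, Matrix.diagonal_mul_diagonal]
      have : ∀ j, ((hω.inv.1.eigenvalues j : ℝ) : ℂ) *
          (((hω.inv.1.eigenvalues j)⁻¹ : ℝ) : ℂ) = 1 := fun j => by
        rw [← Complex.ofReal_mul, mul_inv_cancel₀ (hω.inv.eigenvalues_pos j).ne',
          Complex.ofReal_one]
      simp only [this, Matrix.diagonal_one, Matrix.mul_one, hV]

/-- `D_max` of the identity against `Q = id_A ⊗ R_ω`: the supremum over states
`ρ` on `A ⊗ B` of the least `λ` with `ρ ≤ 2^λ (ρ_A ⊗ ω)` equals `log₂` of the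
sum of the `min (dim A) (dim B)` largest eigenvalues of `ω⁻¹`. -/
theorem stmt12 (dA dB : ℕ) (hA : 0 < dA) (hB : 0 < dB)
    (ω : Matrix (Fin dB) (Fin dB) ℂ) (hω : ω.PosDef) (htr : ω.trace = 1) :
    IsGreatest
      {x : ℝ | ∃ ρ : Matrix (Fin dA × Fin dB) (Fin dA × Fin dB) ℂ,
        ρ.PosSemidef ∧ ρ.trace = 1 ∧
        x = sInf {l : ℝ | 0 ≤ l ∧
          (((2 : ℝ) ^ l) •
            ((Matrix.of fun a a' : Fin dA => ∑ b, ρ (a, b) (a', b)) ⊗ₖ ω) -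
              ρ).PosSemidef}}
      (Real.logb 2 (sSup {y : ℝ | ∃ s : Finset (Fin dB), s.card = min dA dB ∧
        y = ∑ j ∈ s, hω.inv.1.eigenvalues j})) := by
  obtain ⟨s, hs, hgreat⟩ := exists_card_eq_isGreatest_sum hω.inv.1.eigenvalues
    (k := min dA dB) (by simp)
  have hV : (hω.inv.1.eigenvectorUnitary : Matrix (Fin dB) (Fin dB) ℂ) *
      (hω.inv.1.eigenvectorUnitary : Matrix (Fin dB) (Fin dB) ℂ).conjTranspose = 1 :=
    Unitary.coe_mul_star_self hω.inv.1.eigenvectorUnitary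
  have hdiag := eq_eigenvectorUnitary_inv_mul hω
  have hpos := hω.inv.eigenvalues_pos
  have hs0 : 0 < s.card := hs ▸ lt_min hA hB
  have hmax : ∀ t : Finset (Fin dB), t.card = s.card →
      ∑ j ∈ t, hω.inv.1.eigenvalues j ≤ ∑ j ∈ s, hω.inv.1.eigenvalues j :=
    fun t ht => hgreat.2 ⟨t, ht.trans hs, rfl⟩
  rw [hgreat.csSup_eq]
  set M := ∑ j ∈ s, hω.inv.1.eigenvalues j with hM
  have hM0 : 0 < M := Finset.sum_pos (fun j _ => hpos j) (Finset.card_pos.1 hs0)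
  have hpow : (2 : ℝ) ^ Real.logb 2 M = M := Real.rpow_logb two_pos (by norm_num) hM0
  have hmem : ∀ ρ : Matrix (Fin dA × Fin dB) (Fin dA × Fin dB) ℂ, ρ.PosSemidef → ρ.trace = 1 →
      Real.logb 2 M ∈ {l : ℝ | 0 ≤ l ∧ (((2 : ℝ) ^ l) • (marginal ρ ⊗ₖ ω) - ρ).PosSemidef} := by
    intro ρ hρ hρ1
    have h := posSemidef_sum_smul_marginal_kronecker_sub hV hpos hdiag hω.1
      (by simpa using hs) hs0 hmax hρ
    refine ⟨Real.logb_nonneg one_lt_two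
      (one_le_of_posSemidef_smul_marginal_kronecker_sub htr hρ1 h), ?_⟩
    rw [hpow]
    exact h
  constructor
  · obtain ⟨ρ, hρ, hρ1, hlow⟩ := exists_pure_state_sum_le (m := Fin dA) hV hpos hdiag hω.1
      (s := s) (by simp [hs]) hs0
    refine ⟨ρ, hρ, hρ1, le_antisymm ?_ (csInf_le ⟨0, fun l hl => hl.1⟩ (hmem ρ hρ hρ1))⟩
    refine le_csInf ⟨_, hmem ρ hρ hρ1⟩ fun l hl => ?_
    rw [Real.logb_le_iff_le_rpow one_lt_two hM0]
    exact hlow _ hl.2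
  · rintro _ ⟨ρ, hρ, hρ1, rfl⟩
    exact csInf_le ⟨0, fun l hl => hl.1⟩ (hmem ρ hρ hρ1)
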